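/- Suppose every vertex of G has degree at least 1 (so min_i d_i ≥ 1), G has at least one edge, and the signless Laplacian D+W is positive definite (equivalently λ_max(−(D+W)) < 0). Then there exists a unique α_c ∈ (0,1) such that λ_max((1−2α_c)D − W) = 0; moreover λ_max((1−2α)D − W) > 0 for all α ∈ [0, α_c) and λ_max((1−2α)D − W) < 0 for all α ∈ (α_c, 1]. -/

import Mathlib

open Matrix Finset

/-- Degree matrix `D = diag(d_1, …, d_N)` with `d_i = Σ_j W i j`. -/
noncomputable def degMat {N : ℕ} (W : Matrix (Fin N) (Fin N) ℝ) : Matrix (Fin N) (Fin N) ℝ :=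
  Matrix.diagonal (fun i => ∑ j, W i j)

/-- `μ` is the largest eigenvalue of `A`. -/
def IsMaxEig {N : ℕ} (A : Matrix (Fin N) (Fin N) ℝ) (μ : ℝ) : Prop :=
  (∃ v : Fin N → ℝ, v ≠ 0 ∧ A.mulVec v = μ • v) ∧
  ∀ ν : ℝ, (∃ v : Fin N → ℝ, v ≠ 0 ∧ A.mulVec v = ν • v) → ν ≤ μ

/-- Rayleigh bound: the quadratic form of a symmetric matrix is at most its largest eigenvalue
times the squared norm. -/
theorem IsMaxEig.dotProduct_mulVec_le {N : ℕ} {A : Matrix (Fin N) (Fin N) ℝ} {μ : ℝ}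
    (h : IsMaxEig A μ) (hA : A.IsSymm) (v : Fin N → ℝ) : v ⬝ᵥ A *ᵥ v ≤ μ * (v ⬝ᵥ v) := by
  have hB : (μ • (1 : Matrix (Fin N) (Fin N) ℝ) - A).IsHermitian := by
    rw [Matrix.IsHermitian, Matrix.conjTranspose_eq_transpose_of_trivial]
    simp [hA.eq]
  have hpsd : (μ • (1 : Matrix (Fin N) (Fin N) ℝ) - A).PosSemidef := by
    rw [hB.posSemidef_iff_eigenvalues_nonneg]
    intro i
    have hi := hB.mulVec_eigenvectorBasis i
    have hne : (hB.eigenvectorBasis i).ofLp ≠ 0 := by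
      simpa using hB.eigenvectorBasis.orthonormal.ne_zero i
    have hle := h.2 (μ - hB.eigenvalues i) ⟨_, hne, by
      rw [Matrix.sub_mulVec, Matrix.smul_mulVec, Matrix.one_mulVec] at hi
      rw [sub_smul, ← hi, sub_sub_cancel]⟩
    simpa using hle
  have hv := hpsd.dotProduct_mulVec_nonneg v
  rw [Matrix.sub_mulVec, Matrix.smul_mulVec, Matrix.one_mulVec, dotProduct_sub,
    dotProduct_smul, star_trivial, smul_eq_mul] at hv
  linarith

/-- The largest eigenvalue is attained by the quadratic form. -/
theorem IsMaxEig.exists_dotProduct_mulVec_eq {N : ℕ} {A : Matrix (Fin N) (Fin N) ℝ} {μ : ℝ}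
    (h : IsMaxEig A μ) : ∃ v : Fin N → ℝ, 0 < v ⬝ᵥ v ∧ v ⬝ᵥ A *ᵥ v = μ * (v ⬝ᵥ v) := by
  obtain ⟨v, hv, he⟩ := h.1
  refine ⟨v, ?_, by rw [he, dotProduct_smul, smul_eq_mul]⟩
  simpa using dotProduct_star_self_pos_iff.2 hv

theorem dotProduct_degMat_mulVec {N : ℕ} (W : Matrix (Fin N) (Fin N) ℝ) (v : Fin N → ℝ) :
    v ⬝ᵥ degMat W *ᵥ v = ∑ i, (∑ j, W i j) * (v i * v i) := by
  simp only [dotProduct, degMat, Matrix.mulVec_diagonal]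
  exact Finset.sum_congr rfl fun i _ => by ring

theorem dotProduct_self_le_degMat {N : ℕ} {W : Matrix (Fin N) (Fin N) ℝ}
    (hdeg : ∀ i, 1 ≤ ∑ j, W i j) (v : Fin N → ℝ) : v ⬝ᵥ v ≤ v ⬝ᵥ degMat W *ᵥ v := by
  rw [dotProduct_degMat_mulVec, dotProduct]
  exact Finset.sum_le_sum fun i _ => le_mul_of_one_le_left (mul_self_nonneg _) (hdeg i)

theorem dotProduct_degMat_le {N : ℕ} {W : Matrix (Fin N) (Fin N) ℝ}
    (hW : ∀ i j, W i j ≤ 1) (v : Fin N → ℝ) : v ⬝ᵥ degMat W *ᵥ v ≤ N * (v ⬝ᵥ v) := by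
  rw [dotProduct_degMat_mulVec, dotProduct, Finset.mul_sum]
  refine Finset.sum_le_sum fun i _ => mul_le_mul_of_nonneg_right ?_ (mul_self_nonneg _)
  simpa using Finset.sum_le_sum fun j (_ : j ∈ Finset.univ) => hW i j

theorem isSymm_smul_degMat_sub {N : ℕ} {W : Matrix (Fin N) (Fin N) ℝ} (hsymm : W.IsSymm)
    (c : ℝ) : (c • degMat W - W).IsSymm := by
  simp [Matrix.IsSymm, degMat, hsymm.eq]

theorem dotProduct_smul_degMat_sub {N : ℕ} (W : Matrix (Fin N) (Fin N) ℝ) (c : ℝ)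
    (v : Fin N → ℝ) :
    v ⬝ᵥ (c • degMat W - W) *ᵥ v = c * (v ⬝ᵥ degMat W *ᵥ v) - v ⬝ᵥ W *ᵥ v := by
  rw [Matrix.sub_mulVec, Matrix.smul_mulVec, dotProduct_sub, dotProduct_smul, smul_eq_mul]

/-- if every vertex has degree at least `1`, `G` has at least one
edge, and the signless Laplacian `D+W` is positive definite, then there exists
a unique `α_c ∈ (0,1)` with `λ_max((1−2α_c)D − W) = 0`; moreover
`λ_max((1−2α)D − W) > 0` for `α ∈ [0,α_c)` and `< 0` for `α ∈ (α_c,1]`. -/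
theorem stmt12 {N : ℕ} (hN : 0 < N) (W : Matrix (Fin N) (Fin N) ℝ)
    (hsymm : W.IsSymm) (h01 : ∀ i j, W i j = 0 ∨ W i j = 1)
    (hdiag : ∀ i, W i i = 0)
    (hdeg : ∀ i, 1 ≤ ∑ j, W i j)
    (hedge : ∃ i j, W i j = 1)
    (hpd : (degMat W + W).PosDef)
    (f : ℝ → ℝ)
    (hf : ∀ α : ℝ, IsMaxEig ((1 - 2*α) • degMat W - W) (f α)) :
    ∃ αc : ℝ, αc ∈ Set.Ioo (0:ℝ) 1 ∧ f αc = 0 ∧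
      (∀ α ∈ Set.Ico (0:ℝ) αc, 0 < f α) ∧
      (∀ α ∈ Set.Ioc αc (1:ℝ), f α < 0) ∧
      (∀ α' ∈ Set.Ioo (0:ℝ) 1, f α' = 0 → α' = αc) := by
  have hW (i j) : W i j ≤ 1 := by rcases h01 i j with h | h <;> simp [h]
  have hray (α : ℝ) (v : Fin N → ℝ) :
      (1 - 2 * α) * (v ⬝ᵥ degMat W *ᵥ v) - v ⬝ᵥ W *ᵥ v ≤ f α * (v ⬝ᵥ v) := by
    rw [← dotProduct_smul_degMat_sub]
    exact (hf α).dotProduct_mulVec_le (isSymm_smul_degMat_sub hsymm _) v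
  have hatt (α : ℝ) : ∃ v : Fin N → ℝ, 0 < v ⬝ᵥ v ∧
      (1 - 2 * α) * (v ⬝ᵥ degMat W *ᵥ v) - v ⬝ᵥ W *ᵥ v = f α * (v ⬝ᵥ v) := by
    simpa only [dotProduct_smul_degMat_sub] using (hf α).exists_dotProduct_mulVec_eq
  have hanti : StrictAnti f := by
    intro α β hαβ
    obtain ⟨v, hv, he⟩ := hatt β
    have h1 := hray α v
    have h2 := dotProduct_self_le_degMat hdeg v
    refine lt_of_mul_lt_mul_right ?_ hv.le
    nlinarith
  have hlip (α β : ℝ) (hαβ : α ≤ β) : f α ≤ f β + 2 * N * (β - α) := by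
    obtain ⟨v, hv, he⟩ := hatt α
    have h1 := hray β v
    have h2 := dotProduct_degMat_le hW v
    have h3 := mul_le_mul_of_nonneg_left h2 (sub_nonneg.2 hαβ)
    refine le_of_mul_le_mul_right ?_ hv
    linarith
  have hcont : Continuous f := by
    refine (LipschitzWith.of_le_add_mul (2 * N : NNReal) fun α β => ?_).continuous
    rw [Real.dist_eq]
    push_cast
    rcases le_total α β with h | h
    · rw [abs_of_nonpos (sub_nonpos.2 h), neg_sub]
      exact hlip α β h
    · have := hanti.antitone h
      have : (0 : ℝ) ≤ 2 * N * |α - β| := by positivity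
      linarith
  have h0 : 0 < f 0 := by
    have h := hray 0 (Pi.single ⟨0, hN⟩ 1)
    have h2 := dotProduct_self_le_degMat hdeg (Pi.single ⟨0, hN⟩ 1)
    simp [hdiag] at h h2
    linarith
  have h1 : f 1 < 0 := by
    obtain ⟨v, hv, he⟩ := hatt 1
    have hne : v ≠ 0 := by
      rintro rfl
      simp at hv
    have hp := hpd.dotProduct_mulVec_pos hne
    rw [star_trivial, Matrix.add_mulVec, dotProduct_add] at hp
    refine neg_of_mul_neg_left ?_ hv.le
    linarith
  obtain ⟨c, hc, hfc⟩ := intermediate_value_Ioo' zero_le_one hcont.continuousOn ⟨h1, h0⟩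
  exact ⟨c, hc, hfc, fun α hα => hfc ▸ hanti hα.2, fun α hα => hfc ▸ hanti hα.1,
    fun α _ hα => hanti.injective (hα.trans hfc.symm)⟩
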